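/- arXiv:math/0201091 — 4 statements merged into one kernel-verified Lean document; each statement's English description precedes it below -/
import Mathlib

section
/- If Γ is a discrete subgroup of SL(2,ℝ), then for every point z of the upper half-plane ℍ the stabilizer {γ ∈ Γ : γ • z = z} is a finite subgroup of Γ; that is, Γ acts on ℍ with finite isotropy. -/
open UpperHalfPlane Matrix

/-- `SL(2,ℝ)`: 2×2 real matrices of determinant 1. -/
abbrev SL2R := Matrix.SpecialLinearGroup (Fin 2) ℝ

/-- The subspace topology on `SL(2,ℝ)` inherited from 2×2 real matrices. -/
instance : TopologicalSpace SL2R :=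
  TopologicalSpace.induced (fun g => (g : Matrix (Fin 2) (Fin 2) ℝ)) inferInstance

/-- `PSL(2,ℝ)`: the quotient of `SL(2,ℝ)` by its center `{±I}`,
with the quotient topology. -/
abbrev PSL2R := SL2R ⧸ Subgroup.center SL2R


theorem finite_stabilizer_of_properSMul {G X : Type*} [Group G] [TopologicalSpace G]
    [IsTopologicalGroup G] [T2Space G] [TopologicalSpace X] [MulAction G X] [ProperSMul G X]
    (Γ : Subgroup G) (hΓ : DiscreteTopology Γ) (x : X) :
    Finite (MulAction.stabilizer Γ x) := by
  have hp := (ProperSMul.isProperMap_smul_pair (G := G) (X := X)).isCompact_preimage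
    (isCompact_singleton (x := (x, x)))
  have hc : IsCompact {g : G | g • x = x} := by
    convert hp.image continuous_fst using 1
    ext g
    simp only [Set.mem_ofPred_eq, Set.mem_image, Set.mem_preimage, Set.mem_singleton_iff,
      Prod.mk.injEq, Prod.exists]
    constructor
    · intro h
      exact ⟨g, x, ⟨h, rfl⟩, rfl⟩
    · rintro ⟨a, b, ⟨h, rfl⟩, rfl⟩
      exact h
  have hcl : IsClosed (Γ : Set G) := Subgroup.isClosed_of_discrete
  have h2 : IsCompact ((↑) ⁻¹' {g : G | g • x = x} : Set Γ) :=
    hcl.isClosedEmbedding_subtypeVal.isCompact_preimage hc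
  exact h2.finite_of_discrete.to_subtype

/-- A discrete subgroup `Γ` of `SL(2,ℝ)` acts on the upper half-plane with
finite isotropy: every point stabilizer is finite. -/
theorem discrete_subgroup_SL2R_finite_stabilizer
    (Γ : Subgroup SL2R) (hΓ : DiscreteTopology Γ) (z : ℍ) :
    Finite (MulAction.stabilizer Γ z) := by
  exact @finite_stabilizer_of_properSMul SL2R ℍ _
    Matrix.SpecialLinearGroup.instTopologicalSpace
    Matrix.SpecialLinearGroup.topologicalGroup inferInstance _ _ inferInstance Γ hΓ z
end

section
/- Let g ≥ 0, r ≥ 0 and ν₁,…,ν_r ≥ 2 be integers satisfying 2g − 2 + Σ_{j=1}^r (1 − 1/ν_j) > 0, and let Γ = Γ(g; ν₁,…,ν_r) be the associated presented group. Then for each j, the image of the generator c_j in Γ has order exactly ν_j. -/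
open scoped commutatorElement

/-- Generators for the presentation `Γ(g; ν₁,…,ν_r)`:
`Sum.inl (Sum.inl i) = aᵢ`, `Sum.inl (Sum.inr i) = bᵢ`, `Sum.inr j = cⱼ`. -/
abbrev FuchsianGen (g r : ℕ) := (Fin g ⊕ Fin g) ⊕ Fin r

/-- The relations `[a₁,b₁]⋯[a_g,b_g] (c₁⋯c_r)⁻¹` and `cⱼ^{νⱼ}` for `1 ≤ j ≤ r`. -/
def fuchsianRels (g r : ℕ) (ν : Fin r → ℕ) : Set (FreeGroup (FuchsianGen g r)) :=
  insert
    ((List.ofFn fun i : Fin g =>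
        ⁅(FreeGroup.of (Sum.inl (Sum.inl i)) : FreeGroup (FuchsianGen g r)),
          FreeGroup.of (Sum.inl (Sum.inr i))⁆).prod *
      ((List.ofFn fun j : Fin r =>
        (FreeGroup.of (Sum.inr j) : FreeGroup (FuchsianGen g r))).prod)⁻¹)
    (Set.range fun j : Fin r =>
      (FreeGroup.of (Sum.inr j) : FreeGroup (FuchsianGen g r)) ^ (ν j))

/-- The presented group
`Γ(g; ν₁,…,ν_r) = ⟨a₁,b₁,…,a_g,b_g,c₁,…,c_r | [a₁,b₁]⋯[a_g,b_g] = c₁⋯c_r, cⱼ^{νⱼ} = 1⟩`. -/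
abbrev FuchsianGroup (g r : ℕ) (ν : Fin r → ℕ) := PresentedGroup (fuchsianRels g r ν)

/-- The image of the generator `cⱼ` in `Γ(g; ν₁,…,ν_r)`. -/
def fuchsianC (g r : ℕ) (ν : Fin r → ℕ) (j : Fin r) : FuchsianGroup g r ν :=
  PresentedGroup.of (Sum.inr j)


theorem aux_pow {R : Type*} [CommRing R] {A : Type*} [Ring A] [Algebra R A] (M : A) (a b : R)
    (h : M * M = (a + b) • M - (a * b) • (1 : A)) (k : ℕ) :
    (a - b) • M ^ k = (a ^ k - b ^ k) • M - (a ^ k * b - b ^ k * a) • (1 : A) := by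
  induction k with
  | zero => simp [← neg_smul]
  | succ k ih =>
    rw [pow_succ, ← smul_mul_assoc, ih, sub_mul, smul_mul_assoc, h, smul_mul_assoc, one_mul]
    module

theorem aux_unit (a b c d e : ℂ) (he : e ≠ 0) (h : a * d - b * c = e) :
    ∃ U : (Matrix (Fin 2) (Fin 2) ℂ)ˣ, U.val = !![a, b; c, d] := by
  have : IsUnit (!![a, b; c, d] : Matrix (Fin 2) (Fin 2) ℂ) := by
    rw [Matrix.isUnit_iff_isUnit_det, Matrix.det_fin_two_of, h]
    exact isUnit_iff_ne_zero.mpr he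
  exact ⟨this.unit, rfl⟩

theorem aux_pow_one (U : (Matrix (Fin 2) (Fin 2) ℂ)ˣ) (a : ℂ) (ha : a ≠ 1) (p : ℕ)
    (hp : a ^ p = 1)
    (h : U.val * U.val = (a + 1) • U.val - (a * 1) • (1 : Matrix (Fin 2) (Fin 2) ℂ)) :
    U ^ p = 1 := by
  have h1 := aux_pow U.val a 1 h p
  rw [hp] at h1
  have h2 : (a - 1) • U.val ^ p = (a - 1) • (1 : Matrix (Fin 2) (Fin 2) ℂ) := by
    rw [h1]; simp only [one_pow]; module
  have h3 := smul_right_injective _ (sub_ne_zero.mpr ha) h2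
  ext1
  simpa using h3

theorem aux_triangle (n q p : ℕ) (hn : 2 ≤ n) (hq : 2 ≤ q) (hp : 2 ≤ p) :
    ∃ (G : Type) (_ : Group G) (x y z : G), x * y * z = 1 ∧ orderOf x = n ∧
      y ^ q = 1 ∧ z ^ p = 1 := by
  obtain ⟨α, hα⟩ : ∃ α : ℂ, IsPrimitiveRoot α p := ⟨_, Complex.isPrimitiveRoot_exp p (by omega)⟩
  obtain ⟨β, hβ⟩ : ∃ α : ℂ, IsPrimitiveRoot α q := ⟨_, Complex.isPrimitiveRoot_exp q (by omega)⟩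
  obtain ⟨γ, hγ⟩ : ∃ α : ℂ, IsPrimitiveRoot α n := ⟨_, Complex.isPrimitiveRoot_exp n (by omega)⟩
  have α0 : α ≠ 0 := hα.ne_zero (by omega)
  have β0 : β ≠ 0 := hβ.ne_zero (by omega)
  have γ0 : γ ≠ 0 := hγ.ne_zero (by omega)
  have α1 : α ≠ 1 := hα.ne_one (by omega)
  have β1 : β ≠ 1 := hβ.ne_one (by omega)
  have γ1 : γ ≠ 1 := hγ.ne_one (by omega)
  obtain ⟨δ, hδ⟩ := IsAlgClosed.exists_pow_nat_eq (α * β / γ) (n := 2) (by norm_num)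
  have hδ' : γ * δ * δ = α * β := by
    rw [mul_assoc, ← sq, hδ]; field_simp
  have δ0 : δ ≠ 0 := by
    rintro rfl
    simp at hδ'
    tauto
  obtain ⟨t, ht⟩ : ∃ t : ℂ, α * β + t + 1 = γ * δ + δ := ⟨γ * δ + δ - α * β - 1, by ring⟩
  obtain ⟨Y, hY⟩ := aux_unit α 1 0 1 α α0 (by ring)
  obtain ⟨Z, hZ⟩ := aux_unit β 0 t 1 β β0 (by ring)
  obtain ⟨D, hD⟩ := aux_unit 1 0 0 (-1) (-1) (by norm_num) (by ring)
  have hYp : Y ^ p = 1 := by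
    apply aux_pow_one Y α α1 p hα.pow_eq_one
    rw [hY]
    ext i j
    fin_cases i <;> fin_cases j <;> simp [Matrix.mul_apply, Fin.sum_univ_two] <;> ring
  have hZp : Z ^ q = 1 := by
    apply aux_pow_one Z β β1 q hβ.pow_eq_one
    rw [hZ]
    ext i j
    fin_cases i <;> fin_cases j <;> simp [Matrix.mul_apply, Fin.sum_univ_two] <;> ring
  have hW : (Y * Z).val = !![α * β + t, 1; t, 1] := by
    rw [Units.val_mul, hY, hZ]
    ext i j
    fin_cases i <;> fin_cases j <;> simp [Matrix.mul_apply, Fin.sum_univ_two]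
  have hWW : (Y * Z).val * (Y * Z).val = (γ * δ + δ) • (Y * Z).val
      - (γ * δ * δ) • (1 : Matrix (Fin 2) (Fin 2) ℂ) := by
    rw [hW, hδ', ← ht]
    ext i j
    fin_cases i <;> fin_cases j <;> simp [Matrix.mul_apply, Fin.sum_univ_two] <;> ring
  have hk := aux_pow (Y * Z).val _ _ hWW
  have hne : γ * δ - δ ≠ 0 := by
    have : γ * δ - δ = (γ - 1) * δ := by ring
    rw [this]
    exact mul_ne_zero (sub_ne_zero.mpr γ1) δ0
  have hcen : ∀ k, (Y * Z) ^ k ∈ Subgroup.center (Matrix (Fin 2) (Fin 2) ℂ)ˣ ↔ n ∣ k := by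
    intro k
    rw [← hγ.pow_eq_one_iff_dvd, Subgroup.mem_center_iff]
    constructor
    · intro h
      have h1 := congrArg Units.val (h D)
      rw [Units.val_mul, Units.val_mul, hD] at h1
      have h2 := congrFun (congrFun h1 0) 1
      simp [Matrix.mul_apply, Fin.sum_univ_two, -Units.val_mul] at h2
      have h3 : ((Y * Z).val ^ k) 0 1 = 0 := by
        linear_combination (1 / 2 : ℂ) * h2
      have h4 := congrFun (congrFun (hk k) 0) 1
      rw [Matrix.smul_apply, h3, hW] at h4
      simp at h4
      have h5 : (γ ^ k - 1) * δ ^ k = 0 := by rw [mul_pow] at h4; linear_combination -h4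
      rcases mul_eq_zero.mp h5 with h6 | h6
      · exact sub_eq_zero.mp h6
      · exact absurd h6 (pow_ne_zero _ δ0)
    · intro h U
      have h1 := hk k
      rw [mul_pow, h, one_mul, sub_self, zero_smul, zero_sub, ← neg_smul] at h1
      ext1
      rw [Units.val_mul, Units.val_mul, Units.val_pow_eq_pow_val]
      apply smul_right_injective _ hne
      show (γ * δ - δ) • (U.val * (Y * Z).val ^ k) = (γ * δ - δ) • ((Y * Z).val ^ k * U.val)
      rw [← mul_smul_comm, ← smul_mul_assoc, h1]
      simp
  let π := QuotientGroup.mk' (Subgroup.center (Matrix (Fin 2) (Fin 2) ℂ)ˣ)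
  have hπ : ∀ k, π (Y * Z) ^ k = 1 ↔ n ∣ k := by
    intro k
    rw [← hcen, ← map_pow]
    exact QuotientGroup.eq_one_iff _
  refine ⟨_, inferInstance, π (Y * Z), π Z⁻¹, π Y⁻¹, ?_, ?_, ?_, ?_⟩
  · rw [← map_mul, ← map_mul]; simp
  · apply Nat.dvd_antisymm
    · exact orderOf_dvd_of_pow_eq_one ((hπ n).2 dvd_rfl)
    · exact (hπ _).1 (pow_orderOf_eq_one _)
  · rw [← map_pow, inv_pow, hZp]; simp
  · rw [← map_pow, inv_pow, hYp]; simp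

theorem aux_order (g r : ℕ) (ν : Fin r → ℕ) (j : Fin r) {G : Type} [Group G]
    (a b : Fin g → G) (c : Fin r → G)
    (h1 : (List.ofFn fun i => ⁅a i, b i⁆).prod = (List.ofFn c).prod)
    (h2 : ∀ k, c k ^ ν k = 1) (h3 : orderOf (c j) = ν j) :
    orderOf (fuchsianC g r ν j) = ν j := by
  apply Nat.dvd_antisymm
  · apply orderOf_dvd_of_pow_eq_one
    have : (PresentedGroup.mk (fuchsianRels g r ν)) (FreeGroup.of (Sum.inr j) ^ ν j) = 1 :=
      PresentedGroup.one_of_mem (Set.mem_insert_of_mem _ ⟨j, rfl⟩)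
    rw [map_pow] at this
    exact this
  · let f : FuchsianGen g r → G := Sum.elim (Sum.elim a b) c
    have hf : ∀ w ∈ fuchsianRels g r ν, FreeGroup.lift f w = 1 := by
      rintro w (rfl | ⟨k, rfl⟩)
      · rw [map_mul, map_inv, map_list_prod, map_list_prod, List.map_ofFn, List.map_ofFn,
          mul_inv_eq_one]
        have e1 : (⇑(FreeGroup.lift f) ∘ fun i : Fin g =>
            ⁅(FreeGroup.of (Sum.inl (Sum.inl i)) : FreeGroup (FuchsianGen g r)),
              FreeGroup.of (Sum.inl (Sum.inr i))⁆) = fun i => ⁅a i, b i⁆ := by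
          funext i
          simp [f, map_commutatorElement]
        have e2 : (⇑(FreeGroup.lift f) ∘ fun j : Fin r =>
            (FreeGroup.of (Sum.inr j) : FreeGroup (FuchsianGen g r))) = c := by
          funext i
          simp [f]
        rw [e1, e2, h1]
      · simpa [f] using h2 k
    have h4 : PresentedGroup.toGroup hf (fuchsianC g r ν j) = c j := by
      unfold fuchsianC
      rw [PresentedGroup.toGroup.of]
      rfl
    rw [← h3, ← h4]
    exact orderOf_map_dvd _ _

theorem aux_prod {ι G : Type*} [Group G] (f : ι → G) {l L : List ι} (h : l.Sublist L)
    (hL : L.Nodup) (hf : ∀ x ∈ L, x ∉ l → f x = 1) : (L.map f).prod = (l.map f).prod := by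
  induction h with
  | slnil => rfl
  | @cons l L a h ih =>
    rw [List.nodup_cons] at hL
    rw [List.map_cons, List.prod_cons, hf a (by simp) (fun h' => hL.1 (h.subset h')), one_mul]
    exact ih hL.2 fun x hx => hf x (List.mem_cons_of_mem _ hx)
  | @cons_cons l L a h ih =>
    rw [List.nodup_cons] at hL
    rw [List.map_cons, List.prod_cons, List.map_cons, List.prod_cons]
    rw [ih hL.2]
    intro x hx hx'
    apply hf x (List.mem_cons_of_mem _ hx)
    rw [List.mem_cons, not_or]
    refine ⟨?_, hx'⟩
    rintro rfl
    exact hL.1 hx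

theorem aux_prod3 {r : ℕ} {G : Type*} [Group G] (i j k : Fin r) (hij : i < j) (hjk : j < k)
    (x y z : G) : (List.ofFn (fun t : Fin r =>
      if t = i then x else if t = j then y else if t = k then z else 1)).prod = x * y * z := by
  have hs : [i, j, k].Sublist (List.finRange r) := by
    apply List.sublist_of_subperm_of_pairwise (r := (· < ·))
    · apply List.subperm_of_subset
      · simp [hij.ne, hjk.ne, (hij.trans hjk).ne]
      · intro x _; exact List.mem_finRange x
    · simp [hij, hjk, hij.trans hjk]
    · exact List.pairwise_lt_finRange r
  rw [List.ofFn_eq_map, aux_prod _ hs (List.nodup_finRange r)]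
  · simp [hij.ne', hjk.ne', (hij.trans hjk).ne', mul_assoc]
  · intro t _ ht
    simp at ht
    simp [ht]

theorem aux_zero (r : ℕ) (ν : Fin r → ℕ) (i k l j : Fin r) (hik : i < k) (hkl : k < l)
    {G : Type} [Group G] (x y z : G) (h : x * y * z = 1) (hx : x ^ ν i = 1) (hy : y ^ ν k = 1)
    (hz : z ^ ν l = 1) (hj : orderOf (if j = i then x else if j = k then y else
      if j = l then z else 1) = ν j) :
    orderOf (fuchsianC 0 r ν j) = ν j := by
  apply aux_order 0 r ν j (G := G) (fun _ => 1) (fun _ => 1)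
    (fun t : Fin r => if t = i then x else if t = k then y else if t = l then z else 1)
  · rw [aux_prod3 i k l hik hkl, h]; simp
  · intro t
    split_ifs with h1 h2 h3
    · rw [h1, hx]
    · rw [h2, hy]
    · rw [h3, hz]
    · simp
  · exact hj

/-- In the presented group `Γ(g; ν₁,…,ν_r)` (under the hyperbolicity condition
`2g − 2 + Σ (1 − 1/νⱼ) > 0`), the image of the generator `cⱼ` has order exactly `νⱼ`. -/
theorem orderOf_fuchsianC (g r : ℕ) (ν : Fin r → ℕ) (hν : ∀ j, 2 ≤ ν j)
    (hyp : 0 < 2 * (g : ℚ) - 2 + ∑ j : Fin r, (1 - 1 / (ν j : ℚ))) :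
    ∀ j : Fin r, orderOf (fuchsianC g r ν j) = ν j := by
  intro j
  rcases g with _ | g
  · have hr : 3 ≤ r := by
      have h1 : ∑ j : Fin r, (1 - 1 / (ν j : ℚ)) ≤ ∑ j : Fin r, (1 : ℚ) := by
        apply Finset.sum_le_sum
        intro i _
        have : (0 : ℚ) ≤ 1 / (ν i : ℚ) := by positivity
        linarith
      simp only [Finset.sum_const, Finset.card_univ, Fintype.card_fin, nsmul_eq_mul, mul_one] at h1
      have h2 : (2 : ℚ) < r := by
        push_cast at hyp
        linarith
      exact_mod_cast h2
    obtain ⟨j, hj⟩ := j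
    rcases j with _ | _ | j
    · obtain ⟨G, _, x, y, z, h, hx, hy, hz⟩ := aux_triangle (ν ⟨0, hj⟩) (ν ⟨1, by omega⟩)
        (ν ⟨2, by omega⟩) (hν _) (hν _) (hν _)
      refine aux_zero r ν ⟨0, hj⟩ ⟨1, by omega⟩ ⟨2, by omega⟩ _ (by simp) (by simp) x y z h
        (by rw [← hx, pow_orderOf_eq_one]) hy hz ?_
      simpa using hx
    · obtain ⟨G, _, x, y, z, h, hx, hy, hz⟩ := aux_triangle (ν ⟨1, hj⟩) (ν ⟨2, by omega⟩)
        (ν ⟨0, by omega⟩) (hν _) (hν _) (hν _)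
      refine aux_zero r ν ⟨0, by omega⟩ ⟨1, hj⟩ ⟨2, by omega⟩ _ (by simp) (by simp) z x y ?_
        hz (by rw [← hx, pow_orderOf_eq_one]) hy ?_
      · rw [mul_assoc]; exact mul_eq_one_comm.mp h
      · simpa using hx
    · obtain ⟨G, _, x, y, z, h, hx, hy, hz⟩ := aux_triangle (ν ⟨j + 2, hj⟩) (ν ⟨0, by omega⟩)
        (ν ⟨1, by omega⟩) (hν _) (hν _) (hν _)
      refine aux_zero r ν ⟨0, by omega⟩ ⟨1, by omega⟩ ⟨j + 2, hj⟩ _ (by simp) (by simp) y z x ?_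
        hy hz (by rw [← hx, pow_orderOf_eq_one]) ?_
      · rw [mul_assoc] at h; exact mul_eq_one_comm.mp h
      · simpa using hx
  · have hn := hν j
    have hord : orderOf (DihedralGroup.r 2 : DihedralGroup (2 * ν j)) = ν j := by
      have : NeZero (2 * ν j) := ⟨by omega⟩
      have h2 : (DihedralGroup.r 2 : DihedralGroup (2 * ν j)) = DihedralGroup.r 1 ^ 2 := by
        rw [DihedralGroup.r_one_pow]; rfl
      rw [h2, orderOf_pow_of_dvd (by norm_num) (by rw [DihedralGroup.orderOf_r_one]; simp),
        DihedralGroup.orderOf_r_one]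
      omega
    apply aux_order (g + 1) r ν j (G := DihedralGroup (2 * ν j))
      (fun i => if i = 0 then DihedralGroup.r 1 else 1)
      (fun i => if i = 0 then DihedralGroup.sr 0 else 1)
      (fun k => if k = j then DihedralGroup.r 2 else 1)
    · have hs : [j].Sublist (List.finRange r) := by simp
      rw [List.ofFn_eq_map (n := r), aux_prod _ hs (List.nodup_finRange r)]
      · have h0 : (List.ofFn fun _ : Fin g => (1 : DihedralGroup (2 * ν j))).prod = 1 := by
          simp
        simp [List.ofFn_succ, Fin.succ_ne_zero, commutatorElement_def]
        norm_num
      · intro t _ ht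
        simp at ht
        simp [ht]
    · intro k
      split_ifs with h
      · subst h
        exact orderOf_dvd_iff_pow_eq_one.mp hord.dvd
      · simp
    · simpa using hord
end

section
/- Let g ≥ 0, r ≥ 0 and ν₁,…,ν_r ≥ 2 be integers satisfying 2g − 2 + Σ_{j=1}^r (1 − 1/ν_j) > 0. Then the presented group Γ(g; ν₁,…,ν_r) is infinite. -/
open scoped commutatorElement

namespace FuchsianAux

open Matrix

/-- abbreviation -/
abbrev SL2 := Matrix.SpecialLinearGroup (Fin 2) ℂ

lemma sq_eq (M : SL2) : (M : Matrix (Fin 2) (Fin 2) ℂ) * M =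
    (M : Matrix (Fin 2) (Fin 2) ℂ).trace • (M : Matrix (Fin 2) (Fin 2) ℂ) - 1 := by
  have hd := M.det_coe
  rw [Matrix.det_fin_two] at hd
  ext i j
  fin_cases i <;> fin_cases j <;> simp [Matrix.mul_apply, Fin.sum_univ_two, Matrix.trace_fin_two]
  · linear_combination -hd
  · ring
  · ring
  · linear_combination -hd

lemma mem_center_of_scalar (M : SL2) (s : ℂ)
    (h : (M : Matrix (Fin 2) (Fin 2) ℂ) = s • (1 : Matrix (Fin 2) (Fin 2) ℂ)) :
    M ∈ Subgroup.center SL2 := by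
  rw [Subgroup.mem_center_iff]
  intro N
  apply Subtype.ext
  rw [Matrix.SpecialLinearGroup.coe_mul, Matrix.SpecialLinearGroup.coe_mul, h]
  simp

lemma pow_formula (M : SL2) (θ : ℂ)
    (ht : (M : Matrix (Fin 2) (Fin 2) ℂ).trace = 2 * Complex.cos θ) (n : ℕ) :
    Complex.sin θ • (M : Matrix (Fin 2) (Fin 2) ℂ) ^ (n + 1) =
      Complex.sin ((n + 1) * θ) • (M : Matrix (Fin 2) (Fin 2) ℂ)
        - Complex.sin (n * θ) • (1 : Matrix (Fin 2) (Fin 2) ℂ) := by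
  induction n with
  | zero => simp
  | succ k ih =>
    rw [pow_succ, ← smul_mul_assoc, ih, sub_mul, smul_mul_assoc, sq_eq, ht, smul_mul_assoc, one_mul]
    have e : Complex.sin ((((k + 1 : ℕ) : ℂ) + 1) * θ) =
        2 * Complex.cos θ * Complex.sin ((k + 1) * θ) - Complex.sin (k * θ) := by
      have e1 : (((k + 1 : ℕ) : ℂ) + 1) * θ = (k + 1) * θ + θ := by push_cast; ring
      have e2 : (k : ℂ) * θ = (k + 1) * θ - θ := by ring
      rw [e1, e2, Complex.sin_add, Complex.sin_sub]; ring
    rw [e]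
    push_cast
    module

lemma pow_mem_center (M : SL2) (p : ℕ) (hp : 2 ≤ p) (θ : ℝ)
    (hs : Real.sin θ ≠ 0) (hsp : Real.sin (p * θ) = 0)
    (ht : (M : Matrix (Fin 2) (Fin 2) ℂ).trace = 2 * Complex.cos θ) :
    M ^ p ∈ Subgroup.center SL2 := by
  obtain ⟨n, rfl⟩ : ∃ n, p = n + 1 := ⟨p - 1, by omega⟩
  have h := pow_formula M θ ht n
  have hs' : Complex.sin θ ≠ 0 := by exact_mod_cast hs
  have hsp' : Complex.sin ((n + 1) * θ) = 0 := by exact_mod_cast hsp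
  rw [hsp', zero_smul, zero_sub] at h
  apply mem_center_of_scalar _ (-(Complex.sin (n * θ) / Complex.sin θ))
  rw [Matrix.SpecialLinearGroup.coe_pow]
  apply smul_right_injective _ hs'
  simp only [h, smul_smul]
  rw [← neg_smul]
  congr 1
  field_simp

lemma sin_pi_div_pos (p : ℕ) (hp : 2 ≤ p) : 0 < Real.sin (Real.pi / p) := by
  have : (2 : ℝ) ≤ p := by exact_mod_cast hp
  apply Real.sin_pos_of_pos_of_lt_pi
  · positivity
  · rw [div_lt_iff₀ (by positivity)]; nlinarith [Real.pi_pos]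

lemma pow_mem_center_pos (M : SL2) (p : ℕ) (hp : 2 ≤ p)
    (ht : (M : Matrix (Fin 2) (Fin 2) ℂ).trace = 2 * Complex.cos ((Real.pi / p : ℝ) : ℂ)) :
    M ^ p ∈ Subgroup.center SL2 := by
  refine pow_mem_center M p hp _ (sin_pi_div_pos p hp).ne' ?_ ht
  have : (p : ℝ) ≠ 0 := by positivity
  rw [mul_div_cancel₀ _ this, Real.sin_pi]

lemma pow_mem_center_neg (M : SL2) (p : ℕ) (hp : 2 ≤ p)
    (ht : (M : Matrix (Fin 2) (Fin 2) ℂ).trace =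
      2 * Complex.cos ((Real.pi - Real.pi / p : ℝ) : ℂ)) :
    M ^ p ∈ Subgroup.center SL2 := by
  refine pow_mem_center M p hp _ ?_ ?_ ht
  · rw [Real.sin_pi_sub]; exact (sin_pi_div_pos p hp).ne'
  have : (p : ℝ) ≠ 0 := by positivity
  have e : (p : ℝ) * (Real.pi - Real.pi / p) = p * Real.pi - Real.pi := by field_simp
  rw [e, Real.sin_sub_pi, Real.sin_nat_mul_pi, neg_zero]

lemma trace_pow (M : SL2) (t : ℝ) (h2 : 2 < t)
    (ht : (M : Matrix (Fin 2) (Fin 2) ℂ).trace = t) (n : ℕ) :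
    ∃ u v : ℝ, 2 ≤ u ∧ u < v ∧ ((M : Matrix (Fin 2) (Fin 2) ℂ) ^ n).trace = u ∧
      ((M : Matrix (Fin 2) (Fin 2) ℂ) ^ (n + 1)).trace = v := by
  induction n with
  | zero => exact ⟨2, t, le_rfl, h2, by simp, by simpa using ht⟩
  | succ k ih =>
    obtain ⟨u, v, hu, huv, h1, h3⟩ := ih
    refine ⟨v, t * v - u, by linarith, by nlinarith, h3, ?_⟩
    have : (M : Matrix (Fin 2) (Fin 2) ℂ) ^ (k + 1 + 1) =
        (t : ℂ) • (M : Matrix (Fin 2) (Fin 2) ℂ) ^ (k + 1) - (M : Matrix (Fin 2) (Fin 2) ℂ) ^ k := by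
      rw [pow_succ, pow_succ, mul_assoc, sq_eq, ht, mul_sub, mul_smul_comm, mul_one]
    rw [this, Matrix.trace_sub, Matrix.trace_smul, h1, h3]
    push_cast; simp

lemma pow_not_mem_center (M : SL2) (t : ℝ) (h2 : 2 < t)
    (ht : (M : Matrix (Fin 2) (Fin 2) ℂ).trace = t) (n : ℕ) (hn : 0 < n) :
    M ^ n ∉ Subgroup.center SL2 := by
  intro h
  obtain ⟨m, rfl⟩ : ∃ m, n = m + 1 := ⟨n - 1, by omega⟩
  obtain ⟨u, v, hu, huv, -, hv⟩ := trace_pow M t h2 ht m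
  rw [Matrix.SpecialLinearGroup.mem_center_iff] at h
  obtain ⟨s, hs, h⟩ := h
  rw [← Matrix.SpecialLinearGroup.coe_pow, ← h] at hv
  simp [Matrix.trace_fin_two] at hv hs
  have : ((v ^ 2 : ℝ) : ℂ) = (4 : ℝ) := by
    push_cast; rw [← hv]
    rcases hs with rfl | rfl <;> norm_num
  have : v ^ 2 = 4 := by exact_mod_cast this
  nlinarith

lemma commTrace (x y z : ℂ) (ζ : ℂ) (hζ : ζ ≠ 0) (hz : ζ + ζ⁻¹ = z) :
    ∃ A B : SL2, (A : Matrix (Fin 2) (Fin 2) ℂ).trace = x ∧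
      (B : Matrix (Fin 2) (Fin 2) ℂ).trace = y ∧
      ((A * B : SL2) : Matrix (Fin 2) (Fin 2) ℂ).trace = z ∧
      ((A * B * A⁻¹ * B⁻¹ : SL2) : Matrix (Fin 2) (Fin 2) ℂ).trace =
        x ^ 2 + y ^ 2 + z ^ 2 - x * y * z - 2 := by
  obtain ⟨A, hA⟩ : ∃ A : SL2, (A : Matrix (Fin 2) (Fin 2) ℂ) = !![x, -1; 1, 0] :=
    ⟨⟨!![x, -1; 1, 0], by simp [Matrix.det_fin_two]⟩, rfl⟩
  obtain ⟨B, hB⟩ : ∃ B : SL2, (B : Matrix (Fin 2) (Fin 2) ℂ) = !![0, ζ; -ζ⁻¹, y] :=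
    ⟨⟨!![0, ζ; -ζ⁻¹, y], by simp [Matrix.det_fin_two, hζ]⟩, rfl⟩
  refine ⟨A, B, ?_, ?_, ?_, ?_⟩
  · simp [Matrix.trace_fin_two, hA]
  · simp [Matrix.trace_fin_two, hB]
  · rw [Matrix.SpecialLinearGroup.coe_mul, hA, hB]
    simp [Matrix.trace_fin_two, ← hz]; ring
  · subst hz
    simp only [Matrix.SpecialLinearGroup.coe_mul, Matrix.SpecialLinearGroup.coe_inv, hA, hB,
      Matrix.adjugate_fin_two_of]
    simp [Matrix.trace_fin_two]
    field_simp
    ring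

lemma split (x y l : ℂ) (hl : l ≠ 0) (hl2 : l ^ 2 ≠ 1) :
    ∃ A B : SL2, (A : Matrix (Fin 2) (Fin 2) ℂ).trace = x ∧
      (B : Matrix (Fin 2) (Fin 2) ℂ).trace = y ∧
      ((A * B : SL2) : Matrix (Fin 2) (Fin 2) ℂ) = !![l, 0; 0, l⁻¹] := by
  have hl3 : l ^ 2 - 1 ≠ 0 := sub_ne_zero.mpr hl2
  obtain ⟨a, ha⟩ : ∃ a : ℂ, a * (l - l⁻¹) = l * x - y := by
    have : l - l⁻¹ ≠ 0 := by
      intro h; apply hl3; field_simp at h; simpa using h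
    exact ⟨(l * x - y) / (l - l⁻¹), by field_simp⟩
  refine ⟨⟨!![a, 1; a * (x - a) - 1, x - a], by simp [Matrix.det_fin_two]⟩,
    ⟨!![(x - a) * l, -l⁻¹; -(a * (x - a) - 1) * l, a * l⁻¹], ?_⟩, ?_, ?_, ?_⟩
  · simp [Matrix.det_fin_two]; field_simp; ring
  · simp [Matrix.trace_fin_two]
  · simp [Matrix.trace_fin_two]; linear_combination -ha
  · change !![a, 1; a * (x - a) - 1, x - a] *
      !![(x - a) * l, -l⁻¹; -(a * (x - a) - 1) * l, a * l⁻¹] = _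
    ext i j
    fin_cases i <;> fin_cases j <;> simp <;> ring

/-- PSL -/
abbrev PSL := SL2 ⧸ Subgroup.center SL2

lemma mk_pow_eq_one {M : SL2} {p : ℕ} (h : M ^ p ∈ Subgroup.center SL2) :
    (QuotientGroup.mk M : PSL) ^ p = 1 := by
  rw [← QuotientGroup.mk_pow]; exact (QuotientGroup.eq_one_iff _).mpr h

lemma infinite_of_hom {G : Type*} [Group G] (f : G →* PSL) (γ : G) (M : SL2) (t : ℝ) (h2 : 2 < t)
    (ht : (M : Matrix (Fin 2) (Fin 2) ℂ).trace = t) (hf : f γ = QuotientGroup.mk M) :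
    Infinite G := by
  by_contra hfin
  rw [not_infinite_iff_finite] at hfin
  obtain ⟨n, hn, h⟩ := (isOfFinOrder_of_finite γ).exists_pow_eq_one
  apply pow_not_mem_center M t h2 ht n hn
  rw [← QuotientGroup.eq_one_iff, QuotientGroup.mk_pow, ← hf, ← map_pow, h, map_one]

/-- hom for g = 0 -/
lemma exists_hom {H : Type*} [Group H] (g r : ℕ) (ν : Fin r → ℕ) (a b : Fin g → H) (c : Fin r → H)
    (h1 : (List.ofFn fun i => ⁅a i, b i⁆).prod = (List.ofFn c).prod)
    (h2 : ∀ j, c j ^ ν j = 1) :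
    ∃ f : FuchsianGroup g r ν →* H, (∀ i, f (PresentedGroup.of (Sum.inl (Sum.inl i))) = a i) ∧
      (∀ i, f (PresentedGroup.of (Sum.inl (Sum.inr i))) = b i) ∧
      ∀ j, f (PresentedGroup.of (Sum.inr j)) = c j := by
  have h : ∀ w ∈ fuchsianRels g r ν, FreeGroup.lift (Sum.elim (Sum.elim a b) c) w = 1 := by
    intro w hw
    rcases hw with rfl | ⟨j, rfl⟩
    · simp only [map_mul, map_inv, map_list_prod, List.map_ofFn, Function.comp_def,
        map_commutatorElement, FreeGroup.lift_apply_of, Sum.elim_inl, Sum.elim_inr]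
      rw [h1]; simp
    · simp [h2]
  refine ⟨PresentedGroup.toGroup h, ?_, ?_, ?_⟩ <;> intro i <;> simp

lemma case_genus (g r : ℕ) (ν : Fin r → ℕ) (hg : 0 < g) : Infinite (FuchsianGroup g r ν) := by
  obtain ⟨f, hf, -, -⟩ := exists_hom (H := Multiplicative ℤ) g r ν
    (fun _ => Multiplicative.ofAdd 1) (fun _ => 1) (fun _ => 1) (by simp) (by simp)
  by_contra hfin
  rw [not_infinite_iff_finite] at hfin
  obtain ⟨n, hn, h⟩ := (isOfFinOrder_of_finite
    (PresentedGroup.of (Sum.inl (Sum.inl ⟨0, hg⟩)) : FuchsianGroup g r ν)).exists_pow_eq_one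
  have := congrArg f h
  rw [map_pow, hf, map_one f, ← ofAdd_nsmul] at this
  have := congrArg Multiplicative.toAdd this
  simp at this
  omega

lemma case_four (k : ℕ) (ν : Fin (k + 4) → ℕ) (hν : ∀ j, 2 ≤ ν j) :
    Infinite (FuchsianGroup 0 (k + 4) ν) := by
  obtain ⟨A, B, hA, hB, hAB⟩ := split (2 * Complex.cos ((Real.pi / ν 0 : ℝ) : ℂ))
    (2 * Complex.cos ((Real.pi / ν 1 : ℝ) : ℂ)) 2 (by norm_num) (by norm_num)
  obtain ⟨C, D, hC, hD, hCD⟩ := split (2 * Complex.cos ((Real.pi / ν 2 : ℝ) : ℂ))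
    (2 * Complex.cos ((Real.pi / ν 3 : ℝ) : ℂ)) 2⁻¹ (by norm_num) (by norm_num)
  have hP : A * B * (C * D) = 1 := by
    apply Subtype.ext
    rw [Matrix.SpecialLinearGroup.coe_mul, hAB, hCD]
    ext i j
    fin_cases i <;> fin_cases j <;> simp
  let c : Fin (k + 4) → PSL := Fin.cons (QuotientGroup.mk A) (Fin.cons (QuotientGroup.mk B)
    (Fin.cons (QuotientGroup.mk C) (Fin.cons (QuotientGroup.mk D) (fun _ => 1))))
  obtain ⟨f, -, -, hf⟩ := exists_hom (H := PSL) 0 (k + 4) ν (fun _ => 1) (fun _ => 1) c (by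
      simp only [c, List.ofFn_succ, Fin.cons_zero, Fin.cons_succ, List.ofFn_zero, List.prod_nil,
        List.prod_cons, List.ofFn_const, List.prod_replicate, one_pow, mul_one]
      rw [← QuotientGroup.mk_mul, ← QuotientGroup.mk_mul, ← QuotientGroup.mk_mul, ← mul_assoc, hP]
      rfl) (by
      intro j
      refine Fin.cases ?_ (fun j => ?_) j
      · exact mk_pow_eq_one (pow_mem_center_pos A _ (hν _) hA)
      refine Fin.cases ?_ (fun j => ?_) j
      · exact mk_pow_eq_one (pow_mem_center_pos B _ (hν _) hB)
      refine Fin.cases ?_ (fun j => ?_) j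
      · exact mk_pow_eq_one (pow_mem_center_pos C _ (hν _) hC)
      refine Fin.cases ?_ (fun j => ?_) j
      · exact mk_pow_eq_one (pow_mem_center_pos D _ (hν _) hD)
      · exact one_pow _)
  refine infinite_of_hom f (PresentedGroup.of (Sum.inr 0) * PresentedGroup.of (Sum.inr 1))
    (A * B) (5 / 2) (by norm_num) ?_ ?_
  · rw [hAB]; simp [Matrix.trace_fin_two]; norm_num
  · rw [map_mul, hf, hf]; rfl

lemma cos_ineq (a b c : ℝ) (ha : 0 < a) (hb : 0 < b) (hc : 0 < c) (ha' : a ≤ Real.pi / 2)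
    (hb' : b ≤ Real.pi / 2) (hc' : c ≤ Real.pi / 2) (h : a + b + c < Real.pi) :
    1 < Real.cos a ^ 2 + Real.cos b ^ 2 + Real.cos c ^ 2 +
      2 * Real.cos a * Real.cos b * Real.cos c := by
  have h1 : 0 < Real.cos (b + c) + Real.cos a := by
    rw [Real.cos_add_cos]
    have := Real.cos_pos_of_mem_Ioo (x := (b + c + a) / 2) ⟨by linarith, by linarith⟩
    have := Real.cos_pos_of_mem_Ioo (x := (b + c - a) / 2) ⟨by linarith, by linarith⟩
    positivity
  have h2 : 0 < Real.cos (b - c) + Real.cos a := by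
    rw [Real.cos_add_cos]
    have := Real.cos_pos_of_mem_Ioo (x := (b - c + a) / 2) ⟨by linarith, by linarith⟩
    have := Real.cos_pos_of_mem_Ioo (x := (b - c - a) / 2) ⟨by linarith, by linarith⟩
    positivity
  have h3 := mul_pos h1 h2
  rw [Real.cos_add, Real.cos_sub] at h3
  have hb2 := Real.sin_sq_add_cos_sq b
  have hc2 := Real.sin_sq_add_cos_sq c
  have : (Real.cos b * Real.cos c - Real.sin b * Real.sin c + Real.cos a) *
      (Real.cos b * Real.cos c + Real.sin b * Real.sin c + Real.cos a) =
      Real.cos a ^ 2 + Real.cos b ^ 2 + Real.cos c ^ 2 +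
      2 * Real.cos a * Real.cos b * Real.cos c - 1 := by
    have e1 : Real.sin b ^ 2 = 1 - Real.cos b ^ 2 := by linarith
    have e2 : Real.sin c ^ 2 = 1 - Real.cos c ^ 2 := by linarith
    linear_combination (-Real.sin c ^ 2) * e1 + (-(1 - Real.cos b ^ 2)) * e2
  linarith

lemma case_three (ν : Fin 3 → ℕ) (hν : ∀ j, 2 ≤ ν j)
    (hyp : (1 : ℚ) / ν 0 + 1 / ν 1 + 1 / ν 2 < 1) :
    Infinite (FuchsianGroup 0 3 ν) := by
  have hyp' : (1 : ℝ) / ν 0 + 1 / ν 1 + 1 / ν 2 < 1 := by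
    have h := (Rat.cast_lt (K := ℝ)).mpr hyp
    push_cast at h
    exact h
  have hpos : ∀ j, 0 < Real.pi / ν j := fun j => by
    have := hν j
    positivity
  have hle : ∀ j, Real.pi / ν j ≤ Real.pi / 2 := fun j => by
    have : (2 : ℝ) ≤ ν j := by exact_mod_cast hν j
    gcongr
  have key := cos_ineq _ _ _ (hpos 0) (hpos 1) (hpos 2) (hle 0) (hle 1) (hle 2) (by
    have := mul_lt_mul_of_pos_left hyp' Real.pi_pos
    calc _ = Real.pi * ((1 : ℝ) / ν 0 + 1 / ν 1 + 1 / ν 2) := by ring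
      _ < _ := by linarith)
  obtain ⟨A, B, hA, hB, hAB, hcomm⟩ := commTrace (2 * Complex.cos ((Real.pi / ν 0 : ℝ) : ℂ))
    (2 * Complex.cos ((Real.pi / ν 1 : ℝ) : ℂ))
    (2 * Complex.cos ((Real.pi - Real.pi / ν 2 : ℝ) : ℂ))
    (Complex.exp (((Real.pi - Real.pi / ν 2 : ℝ) : ℂ) * Complex.I)) (Complex.exp_ne_zero _)
    (by rw [← Complex.exp_neg, Complex.two_cos, neg_mul])
  let c : Fin 3 → PSL := ![QuotientGroup.mk A, QuotientGroup.mk B, (QuotientGroup.mk (A * B))⁻¹]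
  obtain ⟨f, -, -, hf⟩ := exists_hom (H := PSL) 0 3 ν (fun _ => 1) (fun _ => 1) c (by
      simp [c, List.ofFn_succ]) (by
      intro j
      fin_cases j
      · exact mk_pow_eq_one (pow_mem_center_pos A _ (hν _) hA)
      · exact mk_pow_eq_one (pow_mem_center_pos B _ (hν _) hB)
      · have := mk_pow_eq_one (pow_mem_center_neg (A * B) _ (hν _) hAB)
        change ((QuotientGroup.mk (A * B))⁻¹ : PSL) ^ ν 2 = 1
        rw [inv_pow, this, inv_one])
  refine infinite_of_hom f (PresentedGroup.of (Sum.inr 0) * PresentedGroup.of (Sum.inr 1) *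
      (PresentedGroup.of (Sum.inr 0))⁻¹ * (PresentedGroup.of (Sum.inr 1))⁻¹)
    (A * B * A⁻¹ * B⁻¹) (4 * (Real.cos (Real.pi / ν 0) ^ 2 + Real.cos (Real.pi / ν 1) ^ 2 +
      Real.cos (Real.pi / ν 2) ^ 2 + 2 * Real.cos (Real.pi / ν 0) * Real.cos (Real.pi / ν 1) *
      Real.cos (Real.pi / ν 2)) - 2) (by linarith) ?_ ?_
  · rw [hcomm, ← Complex.ofReal_cos, ← Complex.ofReal_cos, ← Complex.ofReal_cos, Real.cos_pi_sub]
    push_cast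
    ring
  · simp only [map_mul, map_inv, hf]; rfl

end FuchsianAux

/-- Under the hyperbolicity condition `2g − 2 + Σ (1 − 1/νⱼ) > 0`, the presented
group `Γ(g; ν₁,…,ν_r)` is infinite. -/
theorem fuchsianGroup_infinite (g r : ℕ) (ν : Fin r → ℕ) (hν : ∀ j, 2 ≤ ν j)
    (hyp : 0 < 2 * (g : ℚ) - 2 + ∑ j : Fin r, (1 - 1 / (ν j : ℚ))) :
    Infinite (FuchsianGroup g r ν) := by
  rcases Nat.eq_zero_or_pos g with rfl | hg
  swap
  · exact FuchsianAux.case_genus g r ν hg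
  by_cases hr : 4 ≤ r
  · obtain ⟨k, rfl⟩ : ∃ k, r = k + 4 := ⟨r - 4, by omega⟩
    exact FuchsianAux.case_four k ν hν
  by_cases hr3 : r = 3
  · subst hr3
    apply FuchsianAux.case_three ν hν
    rw [Fin.sum_univ_three] at hyp
    push_cast at hyp
    linarith
  · exfalso
    have hle : ∑ j : Fin r, (1 - 1 / (ν j : ℚ)) ≤ ∑ j : Fin r, (1 : ℚ) := by
      apply Finset.sum_le_sum
      intro j _
      have : (0 : ℚ) ≤ 1 / (ν j : ℚ) := by positivity
      linarith
    have hr2 : (r : ℚ) ≤ 2 := by exact_mod_cast (by omega : r ≤ 2)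
    simp at hle hyp
    linarith
end

section
/- Let Γ be a cocompact Fuchsian group and H a nontrivial finite subgroup of Γ. Then there is a unique maximal finite subgroup M of Γ containing H. -/
open UpperHalfPlane Matrix

lemma sl_topGroup : IsTopologicalGroup SL2R :=
  @Matrix.SpecialLinearGroup.topologicalGroup (Fin 2) ℝ _ _ _ _ _

lemma sl_emb : Topology.IsClosedEmbedding (fun g : SL2R => (g : Matrix (Fin 2) (Fin 2) ℝ)) := by
  have h : IsClosed {A : Matrix (Fin 2) (Fin 2) ℝ | A.det = 1} :=
    isClosed_eq (Continuous.matrix_det continuous_id) continuous_const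
  exact h.isClosedEmbedding_subtypeVal

lemma sl_t2 : T2Space SL2R := sl_emb.isEmbedding.t2Space

/-- commuting with a common non-scalar -/
lemma comm_lemma (k g A : Matrix (Fin 2) (Fin 2) ℝ) (hk : k * A = A * k) (hg : g * A = A * g)
    (hA : A 0 1 ≠ 0 ∨ A 1 0 ≠ 0 ∨ A 0 0 ≠ A 1 1) : k * g = g * k := by
  have e1 := congrFun₂ hk 0 0
  have e2 := congrFun₂ hk 0 1
  have e3 := congrFun₂ hk 1 0
  have f1 := congrFun₂ hg 0 0
  have f2 := congrFun₂ hg 0 1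
  have f3 := congrFun₂ hg 1 0
  simp only [Matrix.mul_apply, Fin.sum_univ_two] at e1 e2 e3 f1 f2 f3
  have hA' : A 0 1 ≠ 0 ∨ A 1 0 ≠ 0 ∨ A 0 0 - A 1 1 ≠ 0 := by
    simpa [sub_ne_zero] using hA
  have key : k 0 1 * g 1 0 = k 1 0 * g 0 1 ∧ (k 0 0 - k 1 1) * g 0 1 = k 0 1 * (g 0 0 - g 1 1) ∧
      (k 0 0 - k 1 1) * g 1 0 = k 1 0 * (g 0 0 - g 1 1) := by
    generalize k 0 0 = a at *
    generalize k 0 1 = b at *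
    generalize k 1 0 = c at *
    generalize k 1 1 = d at *
    generalize g 0 0 = a' at *
    generalize g 0 1 = b' at *
    generalize g 1 0 = c' at *
    generalize g 1 1 = d' at *
    generalize A 0 0 = p at *
    generalize A 0 1 = q at *
    generalize A 1 0 = r at *
    generalize A 1 1 = s at *
    have E1 : b * r = c * q := by linarith
    have E2 : (a - d) * q = b * (p - s) := by linarith
    have E3 : (a - d) * r = c * (p - s) := by linarith
    have F1 : b' * r = c' * q := by linarith
    have F2 : (a' - d') * q = b' * (p - s) := by linarith
    have F3 : (a' - d') * r = c' * (p - s) := by linarith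
    generalize a - d = x at *
    generalize a' - d' = x' at *
    generalize p - s = t at *
    rcases hA' with h | h | h
    · refine ⟨?_, ?_, ?_⟩ <;> apply mul_left_cancel₀ h <;> grind
    · refine ⟨?_, ?_, ?_⟩ <;> apply mul_left_cancel₀ h <;> grind
    · refine ⟨?_, ?_, ?_⟩ <;> apply mul_left_cancel₀ h <;> grind
  obtain ⟨k1, k2, k3⟩ := key
  ext i j
  fin_cases i <;> fin_cases j <;> simp [Matrix.mul_apply, Fin.sum_univ_two] <;> linarith

lemma center_pm (z : SL2R) (hz : z ∈ Subgroup.center SL2R) :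
    (z : Matrix (Fin 2) (Fin 2) ℝ) = 1 ∨ (z : Matrix (Fin 2) (Fin 2) ℝ) = -1 := by
  obtain ⟨r, hr, h⟩ := Matrix.SpecialLinearGroup.mem_center_iff.1 hz
  have : r = 1 ∨ r = -1 := by simpa using hr
  rcases this with rfl | rfl
  · left; rw [← h]; simp
  · right; rw [← h]; ext i j; fin_cases i <;> fin_cases j <;> simp

/-- Gram matrix on PSL -/
noncomputable def gram : PSL2R → Matrix (Fin 2) (Fin 2) ℝ :=
  Quotient.lift (fun x : SL2R => (x : Matrix (Fin 2) (Fin 2) ℝ)ᵀ * (x : Matrix (Fin 2) (Fin 2) ℝ)) (by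
    intro a b hab
    have h : a⁻¹ * b ∈ Subgroup.center SL2R := QuotientGroup.leftRel_apply.1 hab
    have hb : b = a * (a⁻¹ * b) := by group
    have := congrArg (fun x : SL2R => (x : Matrix (Fin 2) (Fin 2) ℝ)) hb
    simp only [Matrix.SpecialLinearGroup.coe_mul a] at this
    rcases center_pm _ h with h | h <;> rw [h] at this <;> simp [this])

lemma gram_mk (x : SL2R) : gram (x : PSL2R) =
    (x : Matrix (Fin 2) (Fin 2) ℝ)ᵀ * (x : Matrix (Fin 2) (Fin 2) ℝ) := rfl

lemma gram_mul (p : PSL2R) (g : SL2R) : gram (p * (g : PSL2R)) =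
    (g : Matrix (Fin 2) (Fin 2) ℝ)ᵀ * gram p * (g : Matrix (Fin 2) (Fin 2) ℝ) := by
  induction p using QuotientGroup.induction_on with
  | H x =>
    rw [← QuotientGroup.mk_mul, gram_mk, gram_mk]
    simp [Matrix.mul_assoc]

/-- invariant form -/
lemma exists_form (K : Subgroup PSL2R) (hK : Finite K) :
    ∃ Q : Matrix (Fin 2) (Fin 2) ℝ, Q 0 1 = Q 1 0 ∧
      (∀ x y : ℝ, x ^ 2 + y ^ 2 ≤ Q 0 0 * x ^ 2 + 2 * Q 0 1 * x * y + Q 1 1 * y ^ 2) ∧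
      ∀ g : SL2R, (g : PSL2R) ∈ K →
        (g : Matrix (Fin 2) (Fin 2) ℝ)ᵀ * Q * (g : Matrix (Fin 2) (Fin 2) ℝ) = Q := by
  classical
  have := Fintype.ofFinite K
  refine ⟨∑ k : K, gram k, ?_, ?_, ?_⟩
  · rw [Matrix.sum_apply, Matrix.sum_apply]
    refine Finset.sum_congr rfl fun k _ => ?_
    obtain ⟨x, hx⟩ := QuotientGroup.mk_surjective (k : PSL2R)
    rw [← hx, gram_mk]
    simp [Matrix.mul_apply, Fin.sum_univ_two]; ring
  · intro x y
    simp only [Matrix.sum_apply, Finset.mul_sum, Finset.sum_mul]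
    rw [← Finset.sum_add_distrib, ← Finset.sum_add_distrib]
    have h1 : x ^ 2 + y ^ 2 = gram ((1 : K) : PSL2R) 0 0 * x ^ 2 +
        2 * gram ((1 : K) : PSL2R) 0 1 * x * y + gram ((1 : K) : PSL2R) 1 1 * y ^ 2 := by
      have : gram ((1 : K) : PSL2R) = 1 := by
        have := gram_mk 1
        simpa using this
      rw [this]; simp
    rw [h1]
    refine Finset.single_le_sum (f := fun k : K => gram (k : PSL2R) 0 0 * x ^ 2 +
        2 * gram (k : PSL2R) 0 1 * x * y + gram (k : PSL2R) 1 1 * y ^ 2) ?_ (Finset.mem_univ 1)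
    intro k _
    obtain ⟨u, hu⟩ := QuotientGroup.mk_surjective (k : PSL2R)
    rw [← hu, gram_mk]
    simp only [Matrix.mul_apply, Fin.sum_univ_two, Matrix.transpose_apply]
    generalize (u : Matrix (Fin 2) (Fin 2) ℝ) = U
    have : 0 ≤ (U 0 0 * x + U 0 1 * y) ^ 2 + (U 1 0 * x + U 1 1 * y) ^ 2 := by positivity
    linarith
  · intro g hg
    rw [Finset.mul_sum, Finset.sum_mul]
    simp_rw [← gram_mul]
    exact Fintype.sum_equiv (Equiv.mulRight (⟨g, hg⟩ : K)) _ _ (fun _ => rfl)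

/-- the matrix J Q -/
def JQ (Q : Matrix (Fin 2) (Fin 2) ℝ) : Matrix (Fin 2) (Fin 2) ℝ := !![0, -1; 1, 0] * Q

lemma pres_iff (Q : Matrix (Fin 2) (Fin 2) ℝ) (g : SL2R) :
    (g : Matrix (Fin 2) (Fin 2) ℝ)ᵀ * Q * (g : Matrix (Fin 2) (Fin 2) ℝ) = Q ↔
    (g : Matrix (Fin 2) (Fin 2) ℝ) * JQ Q = JQ Q * (g : Matrix (Fin 2) (Fin 2) ℝ) := by
  have hdet : (g : Matrix (Fin 2) (Fin 2) ℝ).det = 1 := g.2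
  generalize (g : Matrix (Fin 2) (Fin 2) ℝ) = G at *
  rw [Matrix.det_fin_two] at hdet
  set J : Matrix (Fin 2) (Fin 2) ℝ := !![0, -1; 1, 0] with hJ
  have hGJ : G * J * Gᵀ = J := by
    ext i j
    fin_cases i <;> fin_cases j <;> simp [hJ, Matrix.mul_apply, Fin.sum_univ_two] <;> linarith
  have hJJ : J * J = -1 := by
    ext i j
    fin_cases i <;> fin_cases j <;> simp [hJ, Matrix.mul_apply, Fin.sum_univ_two]
  have hu : IsUnit G := by
    rw [Matrix.isUnit_iff_isUnit_det, Matrix.det_fin_two, hdet]; exact isUnit_one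
  unfold JQ
  rw [← hJ]
  constructor
  · intro h
    calc G * (J * Q) = G * (J * (Gᵀ * Q * G)) := by rw [h]
      _ = (G * J * Gᵀ) * Q * G := by simp only [Matrix.mul_assoc]
      _ = _ := by rw [hGJ]
  · intro h
    have h1 : G * (J * (Gᵀ * Q * G)) = G * (J * Q) := by
      rw [h]
      calc _ = (G * J * Gᵀ) * Q * G := by simp only [Matrix.mul_assoc]
      _ = _ := by rw [hGJ]
    have h2 := hu.mul_left_cancel h1
    have h3 := congrArg (fun X => J * X) h2
    simpa [← Matrix.mul_assoc, hJJ] using h3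

lemma JQ_nonscalar (Q : Matrix (Fin 2) (Fin 2) ℝ)
    (h : ∀ x y : ℝ, x ^ 2 + y ^ 2 ≤ Q 0 0 * x ^ 2 + 2 * Q 0 1 * x * y + Q 1 1 * y ^ 2) :
    JQ Q 1 0 ≠ 0 := by
  have h0 := h 1 0
  simp [JQ, Matrix.mul_apply, Fin.sum_univ_two]
  intro h1
  rw [h1] at h0
  norm_num at h0

lemma nonscalar_of (g : SL2R) (hg : (g : PSL2R) ≠ 1) :
    (g : Matrix (Fin 2) (Fin 2) ℝ) 0 1 ≠ 0 ∨ (g : Matrix (Fin 2) (Fin 2) ℝ) 1 0 ≠ 0 ∨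
    (g : Matrix (Fin 2) (Fin 2) ℝ) 0 0 ≠ (g : Matrix (Fin 2) (Fin 2) ℝ) 1 1 := by
  by_contra! hcon
  obtain ⟨h1, h2, h3⟩ := hcon
  apply hg
  rw [QuotientGroup.eq_one_iff, Subgroup.mem_center_iff]
  intro k
  ext i j
  fin_cases i <;> fin_cases j <;>
    simp [Matrix.mul_apply, Fin.sum_univ_two, h1, h2, h3, mul_comm]

lemma cent_compact (g : SL2R) (hg : (g : PSL2R) ≠ 1) (H : Subgroup PSL2R) (hH : Finite H)
    (hgH : (g : PSL2R) ∈ H) :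
    IsCompact {k : SL2R | (k : Matrix (Fin 2) (Fin 2) ℝ) * g = g * (k : Matrix (Fin 2) (Fin 2) ℝ)} := by
  obtain ⟨Q, hs, hp, hQ⟩ := exists_form H hH
  have hgA := (pres_iff Q g).1 (hQ g hgH)
  set C := max (Q 0 0) (Q 1 1)
  have hcpt : IsCompact (Set.pi Set.univ fun _ : Fin 2 => Set.pi Set.univ fun _ : Fin 2 =>
      Set.Icc (-(C + 1)) (C + 1)) :=
    isCompact_univ_pi fun _ => isCompact_univ_pi fun _ => isCompact_Icc
  have hcpt2 := sl_emb.isCompact_preimage hcpt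
  refine hcpt2.of_isClosed_subset ?_ ?_
  · refine isClosed_eq ?_ ?_
    · exact sl_emb.continuous.matrix_mul continuous_const
    · exact continuous_const.matrix_mul sl_emb.continuous
  · intro k hk
    have hkA : (k : Matrix (Fin 2) (Fin 2) ℝ) * JQ Q = JQ Q * (k : Matrix (Fin 2) (Fin 2) ℝ) :=
      comm_lemma _ _ _ hk hgA.symm (nonscalar_of g hg)
    have hkQ := (pres_iff Q k).2 hkA
    have e0 := congrFun₂ hkQ 0 0
    have e1 := congrFun₂ hkQ 1 1
    simp only [Matrix.mul_apply, Fin.sum_univ_two, Matrix.transpose_apply] at e0 e1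
    have p0 := hp (k 0 0) (k 1 0)
    have p1 := hp (k 0 1) (k 1 1)
    rw [← hs] at e0 e1
    have c0 : Q 0 0 ≤ C := le_max_left _ _
    have c1 : Q 1 1 ≤ C := le_max_right _ _
    have b0 : k 0 0 ^ 2 + k 1 0 ^ 2 ≤ C := by linarith
    have b1 : k 0 1 ^ 2 + k 1 1 ^ 2 ≤ C := by linarith
    have aux : ∀ x y : ℝ, x ^ 2 + y ^ 2 ≤ C → (-(C + 1) ≤ x ∧ x ≤ C + 1) ∧ (-(C + 1) ≤ y ∧ y ≤ C + 1) := by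
      intro x y h
      refine ⟨⟨?_, ?_⟩, ?_, ?_⟩ <;>
        nlinarith [sq_nonneg (x + 1), sq_nonneg (x - 1), sq_nonneg (y + 1), sq_nonneg (y - 1),
          sq_nonneg x, sq_nonneg y]
    intro i _ j _
    fin_cases i <;> fin_cases j
    · exact (aux _ _ b0).1
    · exact (aux _ _ b1).1
    · exact (aux _ _ b0).2
    · exact (aux _ _ b1).2

theorem unique_maximal_finite_subgroup
    (Γ : Subgroup PSL2R) (hd : DiscreteTopology Γ) (hc : CompactSpace (PSL2R ⧸ Γ))
    (H : Subgroup PSL2R) (hHΓ : H ≤ Γ) (hHbot : H ≠ ⊥) (hHfin : Finite H) :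
    ∃! M : Subgroup PSL2R, M ≤ Γ ∧ Finite M ∧ H ≤ M ∧
      ∀ K : Subgroup PSL2R, K ≤ Γ → Finite K → M ≤ K → K = M := by
  have := sl_topGroup
  have := sl_t2
  obtain ⟨h, hhH, hh1⟩ := (Subgroup.ne_bot_iff_exists_ne_one.1 hHbot : ∃ a : H, a ≠ 1).elim
    (fun a ha => (⟨a.1, a.2, fun h => ha (Subtype.ext h)⟩ : ∃ h, h ∈ H ∧ h ≠ 1))
  obtain ⟨g, rfl⟩ := QuotientGroup.mk_surjective h
  let M : Subgroup PSL2R := Γ ⊓ (Subgroup.centralizer {g}).map (QuotientGroup.mk' _)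
  have hcomm : ∀ k : SL2R, k ∈ Subgroup.centralizer {g} ↔
      (k : Matrix (Fin 2) (Fin 2) ℝ) * g = g * (k : Matrix (Fin 2) (Fin 2) ℝ) := by
    intro k
    rw [Subgroup.mem_centralizer_singleton_iff, ← Matrix.SpecialLinearGroup.coe_mul,
      ← Matrix.SpecialLinearGroup.coe_mul]
    exact ⟨fun h => by rw [h], fun h => Subtype.ext h⟩
  have hmax : ∀ K : Subgroup PSL2R, K ≤ Γ → Finite K → H ≤ K → K ≤ M := by
    intro K hKΓ hK hHK k hk
    refine ⟨hKΓ hk, ?_⟩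
    obtain ⟨x, rfl⟩ := QuotientGroup.mk_surjective k
    refine ⟨x, ?_, rfl⟩
    obtain ⟨Q, hs, hp, hQ⟩ := exists_form K hK
    exact (hcomm x).2 (comm_lemma _ _ _ ((pres_iff Q x).1 (hQ x hk))
      ((pres_iff Q g).1 (hQ g (hHK hhH))) (Or.inr (Or.inl (JQ_nonscalar Q hp))))
  have hMfin : Finite M := by
    have hcl : IsClosed ((Subgroup.center SL2R : Subgroup SL2R) : Set SL2R) := by
      have : ((Subgroup.center SL2R : Subgroup SL2R) : Set SL2R) =
          ⋂ y : SL2R, {x | y * x = x * y} := by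
        ext x; simp [Subgroup.mem_center_iff]
      rw [this]
      exact isClosed_iInter fun y => isClosed_eq (by fun_prop) (by fun_prop)
    have : T3Space PSL2R := by
      have := hcl
      infer_instance
    have hΓ : IsClosed (Γ : Set PSL2R) := Subgroup.isClosed_of_discrete
    have hC := (cent_compact g hh1 H hHfin hhH).image
      (QuotientGroup.continuous_mk (N := Subgroup.center SL2R))
    have hM : IsCompact ((Γ : Set PSL2R) ∩ _) := hC.inter_left hΓ
    have hfin := hM.finite (IsDiscrete.mono (s := (Γ : Set PSL2R)) ⟨hd⟩ Set.inter_subset_left)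
    refine (hfin.subset ?_).to_subtype
    rintro _ ⟨h1, x, hx, rfl⟩
    exact ⟨h1, x, (hcomm x).1 hx, rfl⟩
  have hHM : H ≤ M := hmax H hHΓ hHfin le_rfl
  refine ⟨M, ⟨inf_le_left, hMfin, hHM, ?_⟩, ?_⟩
  · intro K h1 h2 h3
    exact le_antisymm (hmax K h1 h2 (hHM.trans h3)) h3
  · rintro N ⟨h1, h2, h3, h4⟩
    exact (h4 M inf_le_left hMfin (hmax N h1 h2 h3)).symm
end
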